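/- Let P ∈ 𝒫ₙ \ {I^{⊗n}} and let Û be the channel representation of R(P). Let V be a 4ⁿ × 4ⁿ matrix all of whose entries lie in the ring ℤ[1/√2], and set W = Û·V (whose entries then also lie in ℤ[1/√2]). Then the smallest denominator exponent of W differs from that of V by at most 1: sde(W) ∈ {sde(V)−1, sde(V), sde(V)+1}. -/

import Mathlib

open Matrix Complex

/-- The four single-qubit Pauli matrices I, X, Y, Z. -/
noncomputable def pauli : Fin 4 → Matrix (Fin 2) (Fin 2) ℂ :=
  ![1, !![0, 1; 1, 0], !![0, -Complex.I; Complex.I, 0], !![1, 0; 0, -1]]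

/-- The n-qubit Pauli matrix A₁ ⊗ ⋯ ⊗ Aₙ (Kronecker product realized entrywise
on the index type `Fin n → Fin 2`). -/
noncomputable def nPauli {n : ℕ} (A : Fin n → Fin 4) :
    Matrix (Fin n → Fin 2) (Fin n → Fin 2) ℂ :=
  fun x y => ∏ j, pauli (A j) (x j) (y j)

/-- R(P) = ½(1+e^{iπ/4})·I + ½(1−e^{iπ/4})·P. -/
noncomputable def RP {n : ℕ} (A : Fin n → Fin 4) :
    Matrix (Fin n → Fin 2) (Fin n → Fin 2) ℂ :=
  ((1 + Complex.exp (Complex.I * Real.pi / 4)) / 2) • 1 +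
    ((1 - Complex.exp (Complex.I * Real.pi / 4)) / 2) • nPauli A

/-- The channel representation: Û_{rs} = (1/2ⁿ)·Tr(P_r U P_s U†). -/
noncomputable def chanRep {n : ℕ} (U : Matrix (Fin n → Fin 2) (Fin n → Fin 2) ℂ) :
    Matrix (Fin n → Fin 4) (Fin n → Fin 4) ℂ :=
  fun r s => (1 / 2 ^ n : ℂ) * (nPauli r * U * nPauli s * Uᴴ).trace

/-- z ∈ ℤ[√2], i.e. z = a + b√2 with a, b ∈ ℤ. -/
def inZsqrt2 (z : ℂ) : Prop := ∃ a b : ℤ, z = (a : ℂ) + (b : ℂ) * Real.sqrt 2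

/-- z ∈ ℤ[1/√2], i.e. z = (a + b√2)/√2^k. -/
def inZinvSqrt2 (z : ℂ) : Prop := ∃ k : ℕ, inZsqrt2 ((Real.sqrt 2 : ℂ) ^ k * z)

/-- The smallest denominator exponent of z ∈ ℤ[1/√2]: the least k with √2^k·z ∈ ℤ[√2]. -/
noncomputable def sde (z : ℂ) : ℕ := sInf {k : ℕ | inZsqrt2 ((Real.sqrt 2 : ℂ) ^ k * z)}

/-- The sde of a matrix: the maximum of the sdes of its entries. -/
noncomputable def sdeMat {n : ℕ} (M : Matrix (Fin n → Fin 4) (Fin n → Fin 4) ℂ) : ℕ :=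
  Finset.univ.sup fun p : (Fin n → Fin 4) × (Fin n → Fin 4) => sde (M p.1 p.2)

theorem ofReal_sqrt_two_mul_self : (Real.sqrt 2 : ℂ) * Real.sqrt 2 = 2 := by
  rw [← Complex.ofReal_mul, Real.mul_self_sqrt zero_le_two, Complex.ofReal_ofNat]

/-- The subring `ℤ[√2]` of `ℂ`. -/
noncomputable def zsqrt2Subring : Subring ℂ where
  carrier := {z | inZsqrt2 z}
  mul_mem' := by
    rintro x y ⟨a, b, rfl⟩ ⟨c, d, rfl⟩
    refine ⟨a * c + 2 * b * d, a * d + b * c, ?_⟩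
    push_cast
    linear_combination (b * d : ℂ) * ofReal_sqrt_two_mul_self
  one_mem' := ⟨1, 0, by simp⟩
  add_mem' := by
    rintro x y ⟨a, b, rfl⟩ ⟨c, d, rfl⟩
    exact ⟨a + c, b + d, by push_cast; ring⟩
  zero_mem' := ⟨0, 0, by simp⟩
  neg_mem' := by
    rintro x ⟨a, b, rfl⟩
    exact ⟨-a, -b, by push_cast; ring⟩

theorem sqrt_two_mem_zsqrt2Subring : (Real.sqrt 2 : ℂ) ∈ zsqrt2Subring :=
  ⟨0, 1, by simp⟩

theorem sqrt_two_pow_mul_mem_of_le {z : ℂ} {k l : ℕ} (hkl : k ≤ l)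
    (hz : (Real.sqrt 2 : ℂ) ^ k * z ∈ zsqrt2Subring) :
    (Real.sqrt 2 : ℂ) ^ l * z ∈ zsqrt2Subring := by
  obtain ⟨m, rfl⟩ := Nat.exists_eq_add_of_le' hkl
  rw [pow_add, mul_assoc]
  exact mul_mem (pow_mem sqrt_two_mem_zsqrt2Subring m) hz

section SdeMat

variable {n : ℕ} {M U : Matrix (Fin n → Fin 4) (Fin n → Fin 4) ℂ} {k : ℕ}

theorem sdeMat_le (hM : ∀ r s, (Real.sqrt 2 : ℂ) ^ k * M r s ∈ zsqrt2Subring) :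
    sdeMat M ≤ k :=
  Finset.sup_le fun p _ => Nat.sInf_le (hM p.1 p.2)

theorem sqrt_two_pow_sdeMat_mul_mem (hM : ∀ r s, inZinvSqrt2 (M r s))
    (r s : Fin n → Fin 4) :
    (Real.sqrt 2 : ℂ) ^ sdeMat M * M r s ∈ zsqrt2Subring :=
  sqrt_two_pow_mul_mem_of_le
    (Finset.le_sup (f := fun p : (Fin n → Fin 4) × (Fin n → Fin 4) => sde (M p.1 p.2))
      (Finset.mem_univ (r, s)))
    (Nat.sInf_mem (hM r s))

theorem sqrt_two_pow_succ_mul_mul_mem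
    (hU : ∀ r s, (Real.sqrt 2 : ℂ) * U r s ∈ zsqrt2Subring)
    (hM : ∀ r s, (Real.sqrt 2 : ℂ) ^ k * M r s ∈ zsqrt2Subring) (r s : Fin n → Fin 4) :
    (Real.sqrt 2 : ℂ) ^ (k + 1) * (U * M) r s ∈ zsqrt2Subring := by
  rw [Matrix.mul_apply, Finset.mul_sum]
  refine sum_mem fun t _ => ?_
  convert mul_mem (hU r t) (hM t s) using 1
  ring

end SdeMat

/-- The Kronecker product of a family of 2 × 2 matrices, on the index type `Fin n → Fin 2`. -/
def piKronecker {n : ℕ} (M : Fin n → Matrix (Fin 2) (Fin 2) ℂ) :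
    Matrix (Fin n → Fin 2) (Fin n → Fin 2) ℂ :=
  fun x y => ∏ j, M j (x j) (y j)

section PiKronecker

variable {n : ℕ}

theorem nPauli_eq_piKronecker (A : Fin n → Fin 4) :
    nPauli A = piKronecker fun j => pauli (A j) := rfl

theorem piKronecker_mul (M N : Fin n → Matrix (Fin 2) (Fin 2) ℂ) :
    piKronecker M * piKronecker N = piKronecker fun j => M j * N j := by
  ext x y
  simp only [Matrix.mul_apply, piKronecker, ← Finset.prod_mul_distrib, Fintype.prod_sum]

theorem trace_piKronecker (M : Fin n → Matrix (Fin 2) (Fin 2) ℂ) :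
    (piKronecker M).trace = ∏ j, (M j).trace := by
  simp only [Matrix.trace, Matrix.diag, piKronecker, Fintype.prod_sum]

theorem piKronecker_one : piKronecker (fun _ : Fin n => 1) = 1 := by
  ext x y
  simp only [piKronecker, Matrix.one_apply, Finset.prod_ite_zero, Finset.prod_const_one,
    Finset.mem_univ, true_imp_iff, funext_iff]

theorem piKronecker_smul (c : Fin n → ℂ) (M : Fin n → Matrix (Fin 2) (Fin 2) ℂ) :
    (piKronecker fun j => c j • M j) = (∏ j, c j) • piKronecker M := by
  ext x y
  simp [piKronecker, Finset.prod_mul_distrib]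

end PiKronecker

section Pauli

theorem pauli_mul_self (a : Fin 4) : pauli a * pauli a = 1 := by
  fin_cases a <;> ext i j <;> fin_cases i <;> fin_cases j <;>
    simp [pauli, Matrix.mul_apply, Fin.sum_univ_two]

theorem star_pauli_apply (a : Fin 4) (i j : Fin 2) :
    star (pauli a i j) = pauli a j i := by
  fin_cases a <;> fin_cases i <;> fin_cases j <;> simp [pauli]

theorem exists_sign_pauli_mul_comm (a b : Fin 4) :
    ∃ c : ℂ, (c = 1 ∨ c = -1) ∧ pauli a * pauli b = c • (pauli b * pauli a) := by
  by_cases h : a = 0 ∨ b = 0 ∨ a = b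
  · refine ⟨1, Or.inl rfl, ?_⟩
    rcases h with rfl | rfl | rfl <;> simp [pauli]
  · refine ⟨-1, Or.inr rfl, ?_⟩
    fin_cases a <;> fin_cases b <;> simp at h <;> ext i j <;> fin_cases i <;> fin_cases j <;>
      simp [pauli]

theorem trace_pauli_mul_pauli (a b : Fin 4) :
    (pauli a * pauli b).trace = if a = b then 2 else 0 := by
  fin_cases a <;> fin_cases b <;>
    simp [pauli, Matrix.trace, Fin.sum_univ_two] <;> norm_num

theorem trace_pauli_mul_mul (a b c : Fin 4) :
    (pauli a * pauli b * pauli c).trace / 2 ∈ ({0, 1, -1, I, -I} : Set ℂ) := by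
  fin_cases a <;> fin_cases b <;> fin_cases c <;>
    simp [pauli, Matrix.trace, Fin.sum_univ_two]

theorem sum_pauli_mul_pauli (i j k l : Fin 2) :
    ∑ a, pauli a i j * pauli a k l = if i = l ∧ j = k then 2 else 0 := by
  fin_cases i <;> fin_cases j <;> fin_cases k <;> fin_cases l <;>
    simp [pauli, Fin.sum_univ_four] <;> norm_num

variable {n : ℕ}

theorem nPauli_mul_self (A : Fin n → Fin 4) : nPauli A * nPauli A = 1 := by
  simp only [nPauli_eq_piKronecker, piKronecker_mul, pauli_mul_self, piKronecker_one]

theorem conjTranspose_nPauli (A : Fin n → Fin 4) : (nPauli A)ᴴ = nPauli A := by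
  ext x y
  simp only [Matrix.conjTranspose_apply, nPauli, star_prod, star_pauli_apply]

theorem nPauli_mul_comm_or_anticomm (A B : Fin n → Fin 4) :
    nPauli A * nPauli B = nPauli B * nPauli A ∨
      nPauli A * nPauli B = -(nPauli B * nPauli A) := by
  choose c hc h using fun j => exists_sign_pauli_mul_comm (A j) (B j)
  have hprod : ∏ j, c j = 1 ∨ ∏ j, c j = -1 := by
    refine Finset.prod_induction c (fun z => z = 1 ∨ z = -1) ?_ (Or.inl rfl) fun j _ => hc j
    rintro x y (rfl | rfl) (rfl | rfl) <;> simp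
  simp only [nPauli_eq_piKronecker, piKronecker_mul, h, piKronecker_smul]
  rcases hprod with h | h <;> simp [h]

theorem trace_nPauli_mul_nPauli (A B : Fin n → Fin 4) :
    (nPauli A * nPauli B).trace = if A = B then 2 ^ n else 0 := by
  simp only [nPauli_eq_piKronecker, piKronecker_mul, trace_piKronecker, trace_pauli_mul_pauli,
    Finset.prod_ite_zero, Finset.mem_univ, true_imp_iff, funext_iff, Finset.prod_const,
    Finset.card_univ, Fintype.card_fin]

theorem trace_nPauli_mul_mul (A B C : Fin n → Fin 4) :
    (nPauli A * nPauli B * nPauli C).trace / 2 ^ n ∈ ({0, 1, -1, I, -I} : Set ℂ) := by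
  have h : (nPauli A * nPauli B * nPauli C).trace / 2 ^ n =
      ∏ j, (pauli (A j) * pauli (B j) * pauli (C j)).trace / 2 := by
    simp [nPauli_eq_piKronecker, piKronecker_mul, trace_piKronecker, Finset.prod_div_distrib]
  rw [h]
  refine Finset.prod_induction _ (· ∈ ({0, 1, -1, I, -I} : Set ℂ)) ?_ (by simp)
    fun j _ => trace_pauli_mul_mul (A j) (B j) (C j)
  rintro x y (rfl | rfl | rfl | rfl | rfl) (rfl | rfl | rfl | rfl | rfl) <;> simp

theorem sum_nPauli_mul_nPauli (x y z w : Fin n → Fin 2) :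
    ∑ r, nPauli r x y * nPauli r z w = if x = w ∧ y = z then 2 ^ n else 0 := by
  have h := Fintype.prod_sum fun (j : Fin n) (a : Fin 4) =>
    pauli a (x j) (y j) * pauli a (z j) (w j)
  simp only [nPauli, ← Finset.prod_mul_distrib]
  rw [← h]
  simp only [sum_pauli_mul_pauli, Finset.prod_ite_zero, Finset.mem_univ, true_imp_iff,
    funext_iff, Finset.prod_const, Finset.card_univ, Fintype.card_fin, forall_and]

theorem sum_trace_nPauli_mul_trace (B C : Matrix (Fin n → Fin 2) (Fin n → Fin 2) ℂ) :
    ∑ r, (B * nPauli r).trace * (nPauli r * C).trace = 2 ^ n * (B * C).trace := by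
  calc ∑ r, (B * nPauli r).trace * (nPauli r * C).trace
      = ∑ r, ∑ p : (Fin n → Fin 2) × (Fin n → Fin 2), ∑ q : (Fin n → Fin 2) × (Fin n → Fin 2),
          B p.1 p.2 * C q.2 q.1 * (nPauli r p.2 p.1 * nPauli r q.1 q.2) := by
        refine Finset.sum_congr rfl fun r _ => ?_
        simp only [Matrix.trace, Matrix.diag, Matrix.mul_apply, ← Fintype.sum_prod_type',
          Finset.sum_mul_sum]
        exact Finset.sum_congr rfl fun _ _ => by ring
    _ = ∑ p : (Fin n → Fin 2) × (Fin n → Fin 2), ∑ q : (Fin n → Fin 2) × (Fin n → Fin 2),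
          B p.1 p.2 * C q.2 q.1 * ∑ r, nPauli r p.2 p.1 * nPauli r q.1 q.2 := by
        rw [Finset.sum_comm]
        refine Finset.sum_congr rfl fun p _ => ?_
        rw [Finset.sum_comm]
        simp only [Finset.mul_sum]
    _ = 2 ^ n * (B * C).trace := by
        simp [sum_nPauli_mul_nPauli, Matrix.trace, Matrix.mul_apply, Fintype.sum_prod_type,
          ite_and, Finset.mul_sum, mul_comm]

end Pauli

section ChanRep

variable {n : ℕ}

theorem chanRep_one : chanRep (1 : Matrix (Fin n → Fin 2) (Fin n → Fin 2) ℂ) = 1 := by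
  ext r s
  simp [chanRep, trace_nPauli_mul_nPauli, Matrix.one_apply]

theorem chanRep_mul (U W : Matrix (Fin n → Fin 2) (Fin n → Fin 2) ℂ) :
    chanRep U * chanRep W = chanRep (U * W) := by
  ext r s
  have h := sum_trace_nPauli_mul_trace (Uᴴ * nPauli r * U) (W * nPauli s * Wᴴ)
  have h1 : (Uᴴ * nPauli r * U * (W * nPauli s * Wᴴ)).trace =
      (nPauli r * (U * W) * nPauli s * (U * W)ᴴ).trace := by
    rw [Matrix.conjTranspose_mul]
    simp only [Matrix.mul_assoc]
    rw [Matrix.trace_mul_comm]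
    simp only [Matrix.mul_assoc]
  have h2 (t) : (Uᴴ * nPauli r * U * nPauli t).trace = (nPauli r * U * nPauli t * Uᴴ).trace := by
    rw [Matrix.trace_mul_comm _ Uᴴ]
    simp only [Matrix.mul_assoc]
  simp only [h1, h2] at h
  simp only [Matrix.mul_apply, chanRep]
  rw [← mul_right_inj' (pow_ne_zero n (two_ne_zero (α := ℂ))), mul_left_comm, ← h,
    Finset.mul_sum, Finset.mul_sum]
  refine Finset.sum_congr rfl fun t _ => ?_
  field_simp
  simp only [Matrix.mul_assoc]

theorem chanRep_conjTranspose (U : Matrix (Fin n → Fin 2) (Fin n → Fin 2) ℂ) :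
    chanRep Uᴴ = (chanRep U)ᵀ := by
  ext r s
  simp only [chanRep, Matrix.transpose_apply, Matrix.conjTranspose_conjTranspose]
  rw [Matrix.mul_assoc, Matrix.trace_mul_comm]
  simp only [Matrix.mul_assoc]

theorem exp_I_mul_pi_div_four :
    Complex.exp (Complex.I * Real.pi / 4) = (Real.sqrt 2 / 2 : ℝ) + (Real.sqrt 2 / 2 : ℝ) * I := by
  rw [← Real.cos_pi_div_four]
  nth_rw 2 [Real.cos_pi_div_four]
  rw [← Real.sin_pi_div_four, Complex.ofReal_cos, Complex.ofReal_sin, ← Complex.exp_mul_I]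
  congr 1
  push_cast
  ring

theorem smul_one_add_smul_nPauli_mul (A : Fin n → Fin 4) (a b c d : ℂ) :
    (a • 1 + b • nPauli A) * (c • 1 + d • nPauli A) =
      (a * c + b * d) • 1 + (a * d + b * c) • nPauli A := by
  simp only [Matrix.add_mul, Matrix.mul_add, Matrix.smul_mul, Matrix.mul_smul, Matrix.one_mul,
    Matrix.mul_one, nPauli_mul_self]
  module

theorem conjTranspose_RP (A : Fin n → Fin 4) :
    (RP A)ᴴ = ((1 + ((Real.sqrt 2 / 2 : ℝ) - (Real.sqrt 2 / 2 : ℝ) * I)) / 2) • 1 +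
      ((1 - ((Real.sqrt 2 / 2 : ℝ) - (Real.sqrt 2 / 2 : ℝ) * I)) / 2) • nPauli A := by
  rw [RP, exp_I_mul_pi_div_four, Matrix.conjTranspose_add, Matrix.conjTranspose_smul,
    Matrix.conjTranspose_smul, conjTranspose_nPauli, Matrix.conjTranspose_one]
  simp [sub_eq_add_neg]

theorem RP_mul_conjTranspose (A : Fin n → Fin 4) : RP A * (RP A)ᴴ = 1 := by
  rw [conjTranspose_RP, RP, smul_one_add_smul_nPauli_mul, exp_I_mul_pi_div_four]
  push_cast
  convert add_zero (1 : Matrix (Fin n → Fin 2) (Fin n → Fin 2) ℂ) using 2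
  · convert one_smul ℂ (1 : Matrix (Fin n → Fin 2) (Fin n → Fin 2) ℂ) using 2
    linear_combination ofReal_sqrt_two_mul_self / 4 -
      (Real.sqrt 2 : ℂ) * Real.sqrt 2 / 8 * Complex.I_mul_I
  · convert zero_smul ℂ (nPauli A) using 2
    linear_combination -ofReal_sqrt_two_mul_self / 4 +
      (Real.sqrt 2 : ℂ) * Real.sqrt 2 / 8 * Complex.I_mul_I

/-- `(a - b P) R(P)ᴴ` for `R(P) = a + b P`; the left factor is `R(P)` moved past a matrix
anticommuting with `P`. -/
theorem reflected_RP_mul_conjTranspose (A : Fin n → Fin 4) :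
    (((1 + Complex.exp (Complex.I * Real.pi / 4)) / 2) • 1 +
      (-((1 - Complex.exp (Complex.I * Real.pi / 4)) / 2)) • nPauli A) * (RP A)ᴴ =
      (Real.sqrt 2 / 2 : ℂ) • (1 + I • nPauli A) := by
  rw [conjTranspose_RP, smul_one_add_smul_nPauli_mul, exp_I_mul_pi_div_four, smul_add, smul_smul]
  push_cast
  congr 2
  · ring
  · ring

theorem I_mul_trace_mem_of_anticomm (A r s : Fin n → Fin 4)
    (h : nPauli A * nPauli s = -(nPauli s * nPauli A)) :
    I * ((nPauli r * nPauli s * nPauli A).trace / 2 ^ n) ∈ zsqrt2Subring := by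
  set t := (nPauli r * nPauli s * nPauli A).trace / 2 ^ n with ht
  have hstar : star t = -t := by
    rw [ht, star_div₀, ← Matrix.trace_conjTranspose, Matrix.conjTranspose_mul,
      Matrix.conjTranspose_mul]
    simp only [conjTranspose_nPauli]
    rw [← Matrix.mul_assoc, h, Matrix.neg_mul, Matrix.trace_neg, Matrix.trace_mul_comm,
      ← Matrix.mul_assoc]
    simp [neg_div]
  have hmem := trace_nPauli_mul_mul r s A
  rw [← ht] at hmem
  rcases hmem with h | h | h | h | h <;> rw [h] at hstar ⊢
  · simp [zero_mem]
  · norm_num [Complex.ext_iff] at hstar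
  · norm_num [Complex.ext_iff] at hstar
  · simp [one_mem]
  · simp [one_mem]

theorem sqrt_two_mul_chanRep_RP_mem (A r s : Fin n → Fin 4) :
    (Real.sqrt 2 : ℂ) * chanRep (RP A) r s ∈ zsqrt2Subring := by
  have hdelta : (nPauli r * nPauli s).trace / 2 ^ n ∈ zsqrt2Subring := by
    rw [trace_nPauli_mul_nPauli]
    split_ifs <;> simp [one_mem, zero_mem]
  rcases nPauli_mul_comm_or_anticomm A s with h | h
  · have hU : RP A * nPauli s = nPauli s * RP A := by
      simp [RP, Matrix.add_mul, Matrix.mul_add, h]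
    rw [chanRep, Matrix.mul_assoc (nPauli r), hU, ← Matrix.mul_assoc, Matrix.mul_assoc,
      RP_mul_conjTranspose, Matrix.mul_one, one_div, inv_mul_eq_div]
    exact mul_mem sqrt_two_mem_zsqrt2Subring hdelta
  · have hU : RP A * nPauli s = nPauli s *
        (((1 + Complex.exp (Complex.I * Real.pi / 4)) / 2) • 1 +
          (-((1 - Complex.exp (Complex.I * Real.pi / 4)) / 2)) • nPauli A) := by
      simp only [RP, Matrix.add_mul, Matrix.mul_add, Matrix.smul_mul, Matrix.mul_smul, h,
        Matrix.one_mul, Matrix.mul_one, neg_smul, smul_neg, Matrix.mul_neg]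
    rw [chanRep, Matrix.mul_assoc (nPauli r), hU, ← Matrix.mul_assoc, Matrix.mul_assoc,
      reflected_RP_mul_conjTranspose]
    convert add_mem hdelta (I_mul_trace_mem_of_anticomm A r s h) using 1
    simp only [Matrix.mul_smul, Matrix.mul_add, Matrix.mul_one, Matrix.trace_smul,
      Matrix.trace_add, smul_eq_mul]
    linear_combination ((nPauli r * nPauli s).trace / 2 ^ n +
      I * ((nPauli r * nPauli s * nPauli A).trace / 2 ^ n)) / 2 *
        ofReal_sqrt_two_mul_self

end ChanRep

/-- for W = Û·V with V having entries in ℤ[1/√2],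
sde(W) ∈ {sde(V)−1, sde(V), sde(V)+1}. -/
theorem sde_mult_chanRep {n : ℕ} (A : Fin n → Fin 4) (hA : A ≠ 0)
    (V : Matrix (Fin n → Fin 4) (Fin n → Fin 4) ℂ)
    (hV : ∀ r s, inZinvSqrt2 (V r s)) :
    sdeMat (chanRep (RP A) * V) + 1 = sdeMat V ∨
      sdeMat (chanRep (RP A) * V) = sdeMat V ∨
      sdeMat (chanRep (RP A) * V) = sdeMat V + 1 := by
  have hU := sqrt_two_mul_chanRep_RP_mem A
  have hW := sqrt_two_pow_succ_mul_mul_mem hU (sqrt_two_pow_sdeMat_mul_mem hV)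
  have hinv : (chanRep (RP A))ᵀ * (chanRep (RP A) * V) = V := by
    rw [← Matrix.mul_assoc, ← chanRep_conjTranspose, chanRep_mul,
      mul_eq_one_comm.mp (RP_mul_conjTranspose A), chanRep_one, Matrix.one_mul]
  have hV' := sqrt_two_pow_succ_mul_mul_mem (fun r s => hU s r)
    (sqrt_two_pow_sdeMat_mul_mem fun r s => ⟨_, hW r s⟩)
  have hle : sdeMat V ≤ sdeMat (chanRep (RP A) * V) + 1 := by
    refine sdeMat_le fun r s => ?_
    conv in V r s => rw [← hinv]
    exact hV' r s
  have hle' := sdeMat_le hW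
  omega
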